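/- Let f be a smooth function on a Riemannian manifold M with |∇f| ≠ 0 on an open set U, let X = ∇f/|∇f|², and let (x₁,...,x_n) be coordinates adapted to the level sets of f with ∂₁ = X and ∂₂,...,∂_n orthonormal at p. Then at p: Σ_{i=2}^n X(X⟨∂_i,∂_i⟩) = −2 Rc(X,X) + 2 div(∇_X X) − 2|X|⁻² ⟨∇_X ∇_X X, X⟩ + 2 Σ_{i=2}^n |∇_{∂_i} X|². -/

import Mathlib

/-!
We formalize Riemannian geometry on a coordinate chart: a Riemannian metric on an open
subset of `ℝⁿ` is given by a smooth field of positive definite symmetric matrices `g`.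
All of the classical objects (Levi-Civita connection via Christoffel symbols, curvature,
Ricci curvature, gradient, Hessian, Laplace–Beltrami operator, divergence, covariant
derivatives of vector fields) are defined below by their standard coordinate formulas.
-/

open scoped BigOperators
open Matrix MeasureTheory

noncomputable section

/-- `i`-th partial derivative of a scalar function on `ℝⁿ`. -/
def pd {n : ℕ} (i : Fin n) (h : (Fin n → ℝ) → ℝ) (x : Fin n → ℝ) : ℝ :=
  fderiv ℝ h x (Pi.single i 1)

/-- Directional derivative of the scalar function `h` at `x` in the direction of the
tangent vector `v` (i.e. `v(h)` at `x`). -/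
def dirDeriv {n : ℕ} (v : Fin n → ℝ) (h : (Fin n → ℝ) → ℝ) (x : Fin n → ℝ) : ℝ :=
  fderiv ℝ h x v

/-- The inner product `⟨v, w⟩` of the tangent vectors `v`, `w` at the point `x`,
with respect to the metric `g`. -/
def gip {n : ℕ} (g : (Fin n → ℝ) → Matrix (Fin n) (Fin n) ℝ) (x v w : Fin n → ℝ) : ℝ :=
  ∑ i, ∑ j, g x i j * v i * w j

/-- `g` is a (smooth) Riemannian metric on the set `U ⊆ ℝⁿ`: a smooth field of
symmetric positive definite matrices. -/
def IsRiemannianMetricOn {n : ℕ} (g : (Fin n → ℝ) → Matrix (Fin n) (Fin n) ℝ)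
    (U : Set (Fin n → ℝ)) : Prop :=
  (∀ i j, ContDiffOn ℝ (⊤ : ℕ∞) (fun x => g x i j) U) ∧ ∀ x ∈ U, (g x).PosDef

/-- Christoffel symbols `Γ^k_{ij}` of the Levi-Civita connection of the metric `g`. -/
def christoffel {n : ℕ} (g : (Fin n → ℝ) → Matrix (Fin n) (Fin n) ℝ) (k i j : Fin n)
    (x : Fin n → ℝ) : ℝ :=
  (1 / 2) * ∑ l, (g x)⁻¹ k l *
    (pd i (fun y => g y j l) x + pd j (fun y => g y i l) x - pd l (fun y => g y i j) x)

/-- Components `R^l_{ijk}` of the Riemann curvature tensor of `g`, so that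
`R(∂ᵢ,∂ⱼ)∂ₖ = ∑ l, R^l_{ijk} ∂_l` where `R(X,Y)Z = ∇_X ∇_Y Z - ∇_Y ∇_X Z - ∇_[X,Y] Z`. -/
def riemann {n : ℕ} (g : (Fin n → ℝ) → Matrix (Fin n) (Fin n) ℝ) (l i j k : Fin n)
    (x : Fin n → ℝ) : ℝ :=
  pd i (christoffel g l j k) x - pd j (christoffel g l i k) x
    + ∑ m, (christoffel g l i m x * christoffel g m j k x
        - christoffel g l j m x * christoffel g m i k x)

/-- The Ricci curvature `Rc(v,w)` at `x`, for tangent vectors `v`, `w`: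
`Rc(Y,Z) = tr (W ↦ R(W,Y)Z)`. -/
def ricci {n : ℕ} (g : (Fin n → ℝ) → Matrix (Fin n) (Fin n) ℝ) (x v w : Fin n → ℝ) : ℝ :=
  ∑ i, ∑ j, (∑ k, riemann g k k i j x) * v i * w j

/-- The covariant derivative `∇_v V` at `x` of the vector field `V` in the
direction of the tangent vector `v` at `x`. -/
def covDeriv {n : ℕ} (g : (Fin n → ℝ) → Matrix (Fin n) (Fin n) ℝ)
    (V : (Fin n → ℝ) → Fin n → ℝ) (v : Fin n → ℝ) (x : Fin n → ℝ) : Fin n → ℝ :=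
  fun k => (∑ i, v i * pd i (fun y => V y k) x)
    + ∑ i, ∑ j, christoffel g k i j x * v i * V x j

/-- The divergence `div V = tr (Y ↦ ∇_Y V)` of the vector field `V`. -/
def divVF {n : ℕ} (g : (Fin n → ℝ) → Matrix (Fin n) (Fin n) ℝ)
    (V : (Fin n → ℝ) → Fin n → ℝ) (x : Fin n → ℝ) : ℝ :=
  ∑ k, covDeriv g V (Pi.single k 1) x k

/-- The gradient `∇f` of a scalar function `f`, with respect to the metric `g`. -/
def grad {n : ℕ} (g : (Fin n → ℝ) → Matrix (Fin n) (Fin n) ℝ) (f : (Fin n → ℝ) → ℝ)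
    (x : Fin n → ℝ) : Fin n → ℝ :=
  fun i => ∑ j, (g x)⁻¹ i j * pd j f x

/-- `|∇f|²` at `x`. -/
def gradNormSq {n : ℕ} (g : (Fin n → ℝ) → Matrix (Fin n) (Fin n) ℝ) (f : (Fin n → ℝ) → ℝ)
    (x : Fin n → ℝ) : ℝ :=
  gip g x (grad g f x) (grad g f x)

/-- The components `(∇²f)_{ij}` of the Hessian of `f`. -/
def hessC {n : ℕ} (g : (Fin n → ℝ) → Matrix (Fin n) (Fin n) ℝ) (f : (Fin n → ℝ) → ℝ)
    (i j : Fin n) (x : Fin n → ℝ) : ℝ :=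
  pd i (pd j f) x - ∑ k, christoffel g k i j x * pd k f x

/-- The Hessian `∇²f(v,w) = ⟨∇_v ∇f, w⟩` evaluated on tangent vectors `v`, `w` at `x`. -/
def hess {n : ℕ} (g : (Fin n → ℝ) → Matrix (Fin n) (Fin n) ℝ) (f : (Fin n → ℝ) → ℝ)
    (x v w : Fin n → ℝ) : ℝ :=
  ∑ i, ∑ j, hessC g f i j x * v i * w j

/-- The Laplace–Beltrami operator `Δf = div (∇ f) = tr_g ∇²f`. -/
def lap {n : ℕ} (g : (Fin n → ℝ) → Matrix (Fin n) (Fin n) ℝ) (f : (Fin n → ℝ) → ℝ)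
    (x : Fin n → ℝ) : ℝ :=
  ∑ i, ∑ j, (g x)⁻¹ i j * hessC g f i j x

/-- The squared Hilbert–Schmidt norm `|∇²f|²` of the Hessian of `f`. -/
def hessNormSq {n : ℕ} (g : (Fin n → ℝ) → Matrix (Fin n) (Fin n) ℝ) (f : (Fin n → ℝ) → ℝ)
    (x : Fin n → ℝ) : ℝ :=
  ∑ i, ∑ j, ∑ k, ∑ l,
    (g x)⁻¹ i k * (g x)⁻¹ j l * hessC g f i j x * hessC g f k l x

/-- The vector field `X = ∇f / |∇f|²`. -/
def vecX {n : ℕ} (g : (Fin n → ℝ) → Matrix (Fin n) (Fin n) ℝ) (f : (Fin n → ℝ) → ℝ)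
    (x : Fin n → ℝ) : Fin n → ℝ :=
  fun i => grad g f x i / gradNormSq g f x

/-- `|X|²` for `X = ∇f / |∇f|²`. -/
def xNormSq {n : ℕ} (g : (Fin n → ℝ) → Matrix (Fin n) (Fin n) ℝ) (f : (Fin n → ℝ) → ℝ)
    (x : Fin n → ℝ) : ℝ :=
  gip g x (vecX g f x) (vecX g f x)

end

section helpers

variable {n : ℕ}

lemma pd_congr {U : Set (Fin n → ℝ)} (hU : IsOpen U) {h h' : (Fin n → ℝ) → ℝ}
    (e : ∀ y ∈ U, h y = h' y) (i : Fin n) {x : Fin n → ℝ} (hx : x ∈ U) :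
    pd i h x = pd i h' x := by
  have : h =ᶠ[nhds x] h' := by
    filter_upwards [hU.mem_nhds hx] with y hy using e y hy
  unfold pd
  rw [this.fderiv_eq]

lemma pd_const (c : ℝ) (i : Fin n) (x : Fin n → ℝ) : pd i (fun _ => c) x = 0 := by
  simp [pd]

lemma gsymm {g : (Fin n → ℝ) → Matrix (Fin n) (Fin n) ℝ} {U : Set (Fin n → ℝ)}
    (hg : IsRiemannianMetricOn g U) {x : Fin n → ℝ} (hx : x ∈ U) (i j : Fin n) :
    g x i j = g x j i := by
  have := (hg.2 x hx).isHermitian.apply j i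
  simpa using this

lemma pd_gsymm {g : (Fin n → ℝ) → Matrix (Fin n) (Fin n) ℝ} {U : Set (Fin n → ℝ)}
    (hU : IsOpen U) (hg : IsRiemannianMetricOn g U) {x : Fin n → ℝ} (hx : x ∈ U)
    (k i j : Fin n) :
    pd k (fun y => g y i j) x = pd k (fun y => g y j i) x :=
  pd_congr hU (fun _ hy => gsymm hg hy i j) k hx

lemma christoffel_symm {g : (Fin n → ℝ) → Matrix (Fin n) (Fin n) ℝ} {U : Set (Fin n → ℝ)}
    (hU : IsOpen U) (hg : IsRiemannianMetricOn g U) {x : Fin n → ℝ} (hx : x ∈ U)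
    (k i j : Fin n) : christoffel g k i j x = christoffel g k j i x := by
  unfold christoffel
  congr 1
  refine Finset.sum_congr rfl fun l _ => ?_
  rw [pd_gsymm hU hg hx l i j]
  ring

lemma lower {g : (Fin n → ℝ) → Matrix (Fin n) (Fin n) ℝ} {U : Set (Fin n → ℝ)}
    (hg : IsRiemannianMetricOn g U) {x : Fin n → ℝ} (hx : x ∈ U) (l i j : Fin n) :
    ∑ k, g x l k * christoffel g k i j x
      = (1 / 2) * (pd i (fun y => g y j l) x + pd j (fun y => g y i l) x
          - pd l (fun y => g y i j) x) := by
  have hdet : IsUnit (g x).det := (hg.2 x hx).det_pos.ne'.isUnit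
  have h1 : g x * (g x)⁻¹ = 1 := Matrix.mul_nonsing_inv _ hdet
  set c : Fin n → ℝ := fun l => (pd i (fun y => g y j l) x + pd j (fun y => g y i l) x
          - pd l (fun y => g y i j) x) with hc
  have h2 : g x *ᵥ ((g x)⁻¹ *ᵥ c) = c := by
    rw [Matrix.mulVec_mulVec, h1, Matrix.one_mulVec]
  have h3 := congrFun h2 l
  change _ = (1 / 2) * c l
  rw [← h3]
  simp only [Matrix.mulVec, dotProduct, christoffel, Finset.mul_sum, hc]
  refine Finset.sum_congr rfl fun k _ => Finset.sum_congr rfl fun m _ => ?_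
  ring

lemma det_diff {m : ℕ} {A : (Fin n → ℝ) → Matrix (Fin m) (Fin m) ℝ} {x : Fin n → ℝ}
    (h : ∀ i j, DifferentiableAt ℝ (fun y => A y i j) x) :
    DifferentiableAt ℝ (fun y => (A y).det) x := by
  simp only [Matrix.det_apply']
  refine DifferentiableAt.fun_sum fun σ _ => ?_
  refine DifferentiableAt.const_mul ?_ _
  exact (HasFDerivAt.finsetProd (g := fun i y => A y (σ i) i)
    fun i _ => (h (σ i) i).hasFDerivAt).differentiableAt

lemma inv_diff {A : (Fin n → ℝ) → Matrix (Fin n) (Fin n) ℝ} {x : Fin n → ℝ}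
    (h : ∀ i j, DifferentiableAt ℝ (fun y => A y i j) x) (h0 : (A x).det ≠ 0)
    (i j : Fin n) : DifferentiableAt ℝ (fun y => (A y)⁻¹ i j) x := by
  simp only [Matrix.inv_def, Ring.inverse_eq_inv', Matrix.smul_apply, smul_eq_mul,
    Matrix.adjugate_apply]
  refine DifferentiableAt.mul ((det_diff h).inv h0) (det_diff fun a b => ?_)
  by_cases hab : a = j
  · subst hab
    simp
  · simp only [Matrix.updateRow_ne hab]
    exact h a b

lemma g_contDiffAt {g : (Fin n → ℝ) → Matrix (Fin n) (Fin n) ℝ} {U : Set (Fin n → ℝ)}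
    (hU : IsOpen U) (hg : IsRiemannianMetricOn g U) {x : Fin n → ℝ} (hx : x ∈ U)
    (i j : Fin n) : ContDiffAt ℝ (⊤ : ℕ∞) (fun y => g y i j) x :=
  (hg.1 i j).contDiffAt (hU.mem_nhds hx)

lemma g_diff {g : (Fin n → ℝ) → Matrix (Fin n) (Fin n) ℝ} {U : Set (Fin n → ℝ)}
    (hU : IsOpen U) (hg : IsRiemannianMetricOn g U) {x : Fin n → ℝ} (hx : x ∈ U)
    (i j : Fin n) : DifferentiableAt ℝ (fun y => g y i j) x :=
  (g_contDiffAt hU hg hx i j).differentiableAt (by simp)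

lemma pdg_diff {g : (Fin n → ℝ) → Matrix (Fin n) (Fin n) ℝ} {U : Set (Fin n → ℝ)}
    (hU : IsOpen U) (hg : IsRiemannianMetricOn g U) {x : Fin n → ℝ} (hx : x ∈ U)
    (k i j : Fin n) : DifferentiableAt ℝ (pd k (fun y => g y i j)) x := by
  have h : ContDiffAt ℝ 1 (fderiv ℝ (fun y => g y i j)) x :=
    (g_contDiffAt hU hg hx i j).fderiv_right (by norm_cast)
  unfold pd
  exact (h.differentiableAt (by simp)).clm_apply (differentiableAt_const _)

lemma christoffel_diff {g : (Fin n → ℝ) → Matrix (Fin n) (Fin n) ℝ} {U : Set (Fin n → ℝ)}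
    (hU : IsOpen U) (hg : IsRiemannianMetricOn g U) {x : Fin n → ℝ} (hx : x ∈ U)
    (k i j : Fin n) : DifferentiableAt ℝ (christoffel g k i j) x := by
  unfold christoffel
  refine DifferentiableAt.const_mul (DifferentiableAt.fun_sum fun l _ => ?_) _
  refine (inv_diff (g_diff hU hg hx) (hg.2 x hx).det_pos.ne' k l).mul ?_
  exact ((pdg_diff hU hg hx _ _ _).add (pdg_diff hU hg hx _ _ _)).sub (pdg_diff hU hg hx _ _ _)

lemma vecX_eq [NeZero n] {g : (Fin n → ℝ) → Matrix (Fin n) (Fin n) ℝ} {U : Set (Fin n → ℝ)}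
    (hg : IsRiemannianMetricOn g U)
    (hblock : ∀ x ∈ U, ∀ j, j ≠ 0 → g x 0 j = 0 ∧ g x j 0 = 0)
    {x : Fin n → ℝ} (hx : x ∈ U) :
    vecX g (fun x => x 0) x = Pi.single 0 1 := by
  have hdet : IsUnit (g x).det := (hg.2 x hx).det_pos.ne'.isUnit
  have h1 : (g x)⁻¹ * g x = 1 := Matrix.nonsing_inv_mul _ hdet
  have ha : 0 < g x 0 0 := (hg.2 x hx).diag_pos
  have hpd : ∀ j, pd j (fun x : Fin n → ℝ => x 0) x = if j = 0 then 1 else 0 := by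
    intro j
    have : HasFDerivAt (fun x : Fin n → ℝ => x 0)
        (ContinuousLinearMap.proj (R := ℝ) (φ := fun _ : Fin n => ℝ) 0) x :=
      (ContinuousLinearMap.proj (R := ℝ) (φ := fun _ : Fin n => ℝ) 0).hasFDerivAt
    unfold pd
    rw [this.fderiv]
    simp [Pi.single_apply, eq_comm]
  have hinv : ∀ i, (g x)⁻¹ i 0 * g x 0 0 = if i = 0 then 1 else 0 := by
    intro i
    have h2 := congrFun (congrFun h1 i) 0
    rw [Matrix.mul_apply, Matrix.one_apply, Finset.sum_eq_single 0] at h2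
    · exact h2
    · intro b _ hb
      rw [(hblock x hx b hb).2, mul_zero]
    · simp
  have hgr : grad g (fun x => x 0) x = Pi.single 0 (g x 0 0)⁻¹ := by
    funext i
    simp only [grad, hpd, mul_ite, mul_one, mul_zero, Finset.sum_ite_eq', Finset.mem_univ,
      if_true]
    have h2 := hinv i
    rw [Pi.single_apply]
    split_ifs at h2 ⊢
    · exact eq_inv_of_mul_eq_one_left h2
    · rcases mul_eq_zero.1 h2 with h | h
      · exact h
      · exact absurd h ha.ne'
  have hn : gradNormSq g (fun x => x 0) x = (g x 0 0)⁻¹ := by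
    simp only [gradNormSq, gip, hgr, Pi.single_apply, mul_ite, ite_mul, mul_zero, zero_mul,
      Finset.sum_ite_eq', Finset.mem_univ, if_true]
    field_simp
  funext i
  simp only [vecX, hn, hgr, Pi.single_apply]
  split_ifs
  · field_simp
  · simp

/-- The key pointwise identity. -/
lemma key [NeZero n] {g : (Fin n → ℝ) → Matrix (Fin n) (Fin n) ℝ}
    {U : Set (Fin n → ℝ)} (hU : IsOpen U) (hg : IsRiemannianMetricOn g U)
    (hblock : ∀ x ∈ U, ∀ j, j ≠ 0 → g x 0 j = 0 ∧ g x j 0 = 0)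
    {p : Fin n → ℝ} (hp : p ∈ U)
    (horth : ∀ i j, i ≠ 0 → j ≠ 0 → g p i j = if i = j then 1 else 0)
    (k : Fin n) (hk : k ≠ 0) :
    pd 0 (pd 0 (fun z => g z k k)) p
      = 2 * (pd 0 (christoffel g k k 0) p
          + ∑ m, christoffel g k 0 m p * christoffel g m k 0 p)
        + 2 * ∑ i, ∑ j, g p i j * christoffel g i k 0 p * christoffel g j k 0 p := by
  have z1 : ∀ (i j : Fin n), j ≠ 0 → ∀ x ∈ U, pd i (fun y => g y 0 j) x = 0 := by
    intro i j hj x hx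
    rw [pd_congr hU (fun y hy => (hblock y hy j hj).1) i hx, pd_const]
  have z2 : ∀ (i j : Fin n), j ≠ 0 → ∀ x ∈ U, pd i (fun y => g y j 0) x = 0 := by
    intro i j hj x hx
    rw [pd_congr hU (fun y hy => (hblock y hy j hj).2) i hx, pd_const]
  -- lowering at `p`
  have low : ∀ l i j, l ≠ 0 → christoffel g l i j p
      = (1 / 2) * (pd i (fun y => g y j l) p + pd j (fun y => g y i l) p
          - pd l (fun y => g y i j) p) := by
    intro l i j hl
    rw [← lower hg hp, Finset.sum_eq_single l]
    · rw [horth l l hl hl]; simp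
    · intro b _ hb
      by_cases hb0 : b = 0
      · subst hb0; rw [(hblock p hp l hl).2, zero_mul]
      · rw [horth l b hl hb0, if_neg (Ne.symm hb), zero_mul]
    · simp
  have low0 : ∀ i j, g p 0 0 * christoffel g 0 i j p
      = (1 / 2) * (pd i (fun y => g y j 0) p + pd j (fun y => g y i 0) p
          - pd 0 (fun y => g y i j) p) := by
    intro i j
    rw [← lower hg hp, Finset.sum_eq_single 0]
    · intro b _ hb
      rw [(hblock p hp b hb).1, zero_mul]
    · simp
  -- h_{kl} = 2 Γ^l_{k0}
  have hh : ∀ l, l ≠ 0 → pd 0 (fun y => g y k l) p = 2 * christoffel g l k 0 p := by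
    intro l hl
    rw [low l k 0 hl, z1 k l hl p hp, z2 l k hk p hp]
    ring
  have hsym : ∀ m, m ≠ 0 → christoffel g k 0 m p = christoffel g m k 0 p := by
    intro m hm
    rw [low k 0 m hk, low m k 0 hm, z1 m k hk p hp, z1 k m hm p hp,
      z2 m k hk p hp, pd_gsymm hU hg hp 0 m k]
    ring
  have h00 : christoffel g k 0 0 p = - (g p 0 0 * christoffel g 0 k 0 p) := by
    rw [low k 0 0 hk, low0 k 0, z1 0 k hk p hp, z2 0 k hk p hp]
    ring
  -- second derivative
  have hsec : pd 0 (pd 0 (fun z => g z k k)) p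
      = ∑ l, 2 * (pd 0 (fun y => g y k l) p * christoffel g l k 0 p
          + g p k l * pd 0 (christoffel g l k 0) p) := by
    have e : ∀ y ∈ U, pd 0 (fun z => g z k k) y
        = ∑ l, 2 * (g y k l * christoffel g l k 0 y) := by
      intro y hy
      rw [← Finset.mul_sum, lower hg hy, z1 k k hk y hy, z2 k k hk y hy]
      ring
    rw [pd_congr hU e 0 hp]
    have hd : ∀ l, DifferentiableAt ℝ (fun y => g y k l * christoffel g l k 0 y) p :=
      fun l => (g_diff hU hg hp k l).mul (christoffel_diff hU hg hp l k 0)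
    unfold pd
    rw [fderiv_fun_sum (fun l _ => (hd l).const_mul 2)]
    rw [_root_.sum_apply]
    refine Finset.sum_congr rfl fun l _ => ?_
    rw [fderiv_const_mul (hd l),
      fderiv_fun_mul (g_diff hU hg hp k l) (christoffel_diff hU hg hp l k 0)]
    simp
    ring
  have hgip : ∀ i, ∑ j, g p i j * christoffel g i k 0 p * christoffel g j k 0 p
      = g p i i * christoffel g i k 0 p * christoffel g i k 0 p := by
    intro i
    rw [Finset.sum_eq_single i]
    · intro b _ hb
      by_cases hi : i = 0
      · subst hi; rw [(hblock p hp b hb).1]; ring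
      · by_cases hb0 : b = 0
        · subst hb0; rw [(hblock p hp i hi).2]; ring
        · rw [horth i b hi hb0, if_neg (Ne.symm hb)]; ring
    · simp
  have hder : pd 0 (christoffel g k k 0) p
      = ∑ l, g p k l * pd 0 (christoffel g l k 0) p := by
    rw [Finset.sum_eq_single k]
    · rw [horth k k hk hk]; simp
    · intro b _ hb
      by_cases hb0 : b = 0
      · subst hb0; rw [(hblock p hp k hk).2, zero_mul]
      · rw [horth k b hk hb0, if_neg (Ne.symm hb), zero_mul]
    · simp
  rw [hsec, hder, ← Finset.sum_add_distrib, Finset.mul_sum, Finset.mul_sum,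
    ← Finset.sum_add_distrib]
  refine Finset.sum_congr rfl fun l _ => ?_
  rw [hgip l]
  by_cases hl : l = 0
  · subst hl
    rw [z2 0 k hk p hp, h00]
    ring
  · rw [hh l hl, hsym l hl, horth l l hl hl, if_pos rfl]
    ring

end helpers

/-- In coordinates `(x₁,…,x_n)` adapted to the level sets of `f` (so `x₁ = f` and
`∂₁ = X = ∇f/|∇f|²`), with `∂₂,…,∂_n` orthonormal at `p`, one has at `p`:
`∑_{i=2}^n X(X⟨∂ᵢ,∂ᵢ⟩) = -2 Rc(X,X) + 2 div(∇_X X) - 2|X|⁻² ⟨∇_X ∇_X X, X⟩`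
`+ 2 ∑_{i=2}^n |∇_{∂ᵢ} X|²`. -/
theorem second_flow_deriv_metric_trace {n : ℕ} [NeZero n]
    (g : (Fin n → ℝ) → Matrix (Fin n) (Fin n) ℝ)
    (U : Set (Fin n → ℝ)) (hU : IsOpen U) (hg : IsRiemannianMetricOn g U)
    (f : (Fin n → ℝ) → ℝ) (hf : f = fun x => x 0)
    (hgrad : ∀ x ∈ U, grad g f x ≠ 0)
    (hblock : ∀ x ∈ U, ∀ j, j ≠ 0 → g x 0 j = 0 ∧ g x j 0 = 0)
    (p : Fin n → ℝ) (hp : p ∈ U)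
    (horth : ∀ i j, i ≠ 0 → j ≠ 0 → g p i j = if i = j then 1 else 0) :
    ∑ i ∈ Finset.univ.filter (fun i => i ≠ (0 : Fin n)),
        dirDeriv (vecX g f p) (fun y => dirDeriv (vecX g f y) (fun z => g z i i) y) p
      = -2 * ricci g p (vecX g f p) (vecX g f p)
        + 2 * divVF g (fun y => covDeriv g (vecX g f) (vecX g f y) y) p
        - 2 * (xNormSq g f p)⁻¹ *
            gip g p
              (covDeriv g (fun y => covDeriv g (vecX g f) (vecX g f y) y) (vecX g f p) p)
              (vecX g f p)
        + 2 * ∑ i ∈ Finset.univ.filter (fun i => i ≠ (0 : Fin n)),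
            gip g p (covDeriv g (vecX g f) (Pi.single i 1) p)
              (covDeriv g (vecX g f) (Pi.single i 1) p) := by
  subst hf
  have hX : ∀ y ∈ U, vecX g (fun x => x 0) y = Pi.single 0 1 :=
    fun y hy => vecX_eq hg hblock hy
  have hXp := hX p hp
  have ha : 0 < g p 0 0 := (hg.2 p hp).diag_pos
  have hcX : ∀ y ∈ U, ∀ v k, covDeriv g (vecX g (fun x => x 0)) v y k
      = ∑ i, christoffel g k i 0 y * v i := by
    intro y hy v k
    have : ∀ i, pd i (fun z => vecX g (fun x => x 0) z k) y = 0 := by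
      intro i
      rw [pd_congr hU (fun z hz => congrFun (hX z hz) k) i hy, pd_const]
    simp [covDeriv, this, hX y hy, Pi.single_apply]
  have hW : ∀ y ∈ U, ∀ k, covDeriv g (vecX g (fun x => x 0)) (vecX g (fun x => x 0) y) y k
      = christoffel g k 0 0 y := by
    intro y hy k
    rw [hcX y hy, hX y hy]
    simp [Pi.single_apply]
  have hpW : ∀ i k, pd i (fun y => covDeriv g (vecX g (fun x => x 0))
      (vecX g (fun x => x 0) y) y k) p = pd i (christoffel g k 0 0) p :=
    fun i k => pd_congr hU (fun y hy => hW y hy k) i hp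
  have hcW : ∀ i k, covDeriv g (fun y => covDeriv g (vecX g (fun x => x 0))
      (vecX g (fun x => x 0) y) y) (Pi.single i 1) p k
      = pd i (christoffel g k 0 0) p
        + ∑ j, christoffel g k i j p * christoffel g j 0 0 p := by
    intro i k
    rw [covDeriv]
    simp only [hpW, hW p hp]
    simp [Pi.single_apply]
  have hL : ∀ i, dirDeriv (vecX g (fun x => x 0) p)
      (fun y => dirDeriv (vecX g (fun x => x 0) y) (fun z => g z i i) y) p
      = pd 0 (pd 0 (fun z => g z i i)) p := by
    intro i
    rw [hXp]
    change pd 0 _ p = _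
    refine pd_congr hU (fun y hy => ?_) 0 hp
    rw [hX y hy]
    rfl
  have hric : ricci g p (Pi.single 0 1) (Pi.single 0 1) = ∑ k, riemann g k k 0 0 p := by
    simp [ricci, Pi.single_apply]
  have hdiv : divVF g (fun y => covDeriv g (vecX g (fun x => x 0))
      (vecX g (fun x => x 0) y) y) p = ∑ k, (pd k (christoffel g k 0 0) p
        + ∑ j, christoffel g k k j p * christoffel g j 0 0 p) := by
    simp only [divVF, hcW]
  have hnorm : xNormSq g (fun x => x 0) p = g p 0 0 := by
    simp [xNormSq, gip, hXp, Pi.single_apply]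
  have hgipX : ∀ v, gip g p v (Pi.single 0 1) = g p 0 0 * v 0 := by
    intro v
    simp only [gip, Pi.single_apply, mul_ite, mul_one, mul_zero, Finset.sum_ite_eq',
      Finset.mem_univ, if_true]
    rw [Finset.sum_eq_single 0]
    · intro b _ hb
      rw [(hblock p hp b hb).2, zero_mul]
    · simp
  have hsq : ∀ i, gip g p (covDeriv g (vecX g (fun x => x 0)) (Pi.single i 1) p)
        (covDeriv g (vecX g (fun x => x 0)) (Pi.single i 1) p)
      = ∑ a, ∑ b, g p a b * christoffel g a i 0 p * christoffel g b i 0 p := by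
    intro i
    have : ∀ k, covDeriv g (vecX g (fun x => x 0)) (Pi.single i 1) p k
        = christoffel g k i 0 p := by
      intro k
      rw [hcX p hp]
      simp [Pi.single_apply]
    simp only [gip, this]
  set T : Fin n → ℝ := fun k => pd 0 (christoffel g k k 0) p
          + ∑ m, christoffel g k 0 m p * christoffel g m k 0 p with hT
  have hdr : -2 * (∑ k, riemann g k k 0 0 p) + 2 * ∑ k, (pd k (christoffel g k 0 0) p
        + ∑ j, christoffel g k k j p * christoffel g j 0 0 p) = 2 * ∑ k, T k := by
    simp only [Finset.mul_sum, ← Finset.sum_add_distrib]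
    refine Finset.sum_congr rfl fun k _ => ?_
    simp only [riemann, hT, Finset.sum_sub_distrib]
    ring
  have hT0 : pd 0 (christoffel g 0 0 0) p
      + ∑ j, christoffel g 0 0 j p * christoffel g j 0 0 p = T 0 := rfl
  have hsplit : ∑ k, T k
      = T 0 + ∑ i ∈ Finset.univ.filter (fun i => i ≠ (0 : Fin n)), T i := by
    rw [Finset.filter_ne', Finset.add_sum_erase _ _ (Finset.mem_univ _)]
  simp only [hL, hsq]
  rw [hXp, hric, hdiv, hdr, hnorm, hgipX, hcW, hT0, hsplit]
  have hcancel : 2 * (g p 0 0)⁻¹ * (g p 0 0 * T 0) = 2 * T 0 := by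
    field_simp
  rw [hcancel, Finset.sum_congr rfl (fun i hi =>
    key hU hg hblock hp horth i (Finset.mem_filter.1 hi).2), Finset.sum_add_distrib,
    ← Finset.mul_sum, ← Finset.mul_sum]
  ring
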